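/- arXiv:1807.00995 — 2 statements merged into one kernel-verified Lean document; each statement's English description precedes it below -/
import Mathlib

section
/- Let E be a compact Polish space and let 𝒦(E) be the hyperspace of compact subsets of E with the Vietoris topology. Suppose I ⊆ 𝒦(E) is a coanalytic, nonempty ideal of compact sets. Then I has property (*) if and only if there exists a closed set 𝓕 ⊆ 𝒦(E) such that for every K ∈ 𝒦(E), K ∈ I if and only if K* ∩ 𝓕 is meager in 𝓕 (meager in the subspace topology of 𝓕). -/
open TopologicalSpace Set

/-- For `A ⊆ E`, `A* = {K ∈ 𝒦(E) : K ∩ A ≠ ∅}`. Here `𝒦(E)` is modeled by the closed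
(equivalently, compact, since `E` is compact) subsets of `E` with the Hausdorff metric
topology, which coincides with the Vietoris topology for compact metric `E`. -/
def starSet {E : Type*} [TopologicalSpace E] (A : Set E) : Set (Closeds E) :=
  {K : Closeds E | ((K : Set E) ∩ A).Nonempty}

/-- `S` is meager in `F` (in the subspace topology of `F`). -/
def MeagerIn {X : Type*} [TopologicalSpace X] (S F : Set X) : Prop :=
  IsMeagre ((Subtype.val : F → X) ⁻¹' S)

/-- An ideal of compact sets: closed under (compact) subsets and finite unions. -/
def IsIdealOfCompacts {E : Type*} [TopologicalSpace E] (I : Set (Closeds E)) : Prop :=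
  (∀ K L : Closeds E, L ≤ K → K ∈ I → L ∈ I) ∧
  (∀ K L : Closeds E, K ∈ I → L ∈ I → K ⊔ L ∈ I)

/-- Property (*): for every sequence of sets in `I` there is a Gδ set `G` containing
their union with `𝒦(G) ⊆ I`. -/
def HasPropertyStar {E : Type*} [TopologicalSpace E] (I : Set (Closeds E)) : Prop :=
  ∀ f : ℕ → Closeds E, (∀ n, f n ∈ I) →
    ∃ G : Set E, IsGδ G ∧ (⋃ n, (f n : Set E)) ⊆ G ∧
      ∀ K : Closeds E, (K : Set E) ⊆ G → K ∈ I

/-- Localization principle: given a hereditary, countably additive family `J` of sets, there is a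
closed set `P` with complement in `J` such that no nonempty relatively open part of `P` is in
`J`. -/
theorem exists_isClosed_forall_isOpen_inter {X : Type*} [TopologicalSpace X]
    [SecondCountableTopology X] (J : Set X → Prop) (mono : ∀ A B, A ⊆ B → J B → J A)
    (sUnion : ∀ 𝒜 : Set (Set X), 𝒜.Countable → (∀ A ∈ 𝒜, J A) → J (⋃₀ 𝒜)) :
    ∃ P : Set X, IsClosed P ∧ J Pᶜ ∧ ∀ V, IsOpen V → J (V ∩ P) → V ∩ P = ∅ := by
  have hb := isBasis_countableBasis X
  set O : Set X := ⋃₀ {V ∈ countableBasis X | J V}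
  have hO : J O :=
    sUnion _ ((countable_countableBasis X).mono fun _ h => h.1) fun _ h => h.2
  have hOo : IsOpen O := isOpen_sUnion fun V hV => hb.isOpen hV.1
  refine ⟨Oᶜ, hOo.isClosed_compl, by rwa [compl_compl], fun V hV hJ => ?_⟩
  by_contra hne
  obtain ⟨x, hxV, hxO⟩ := nonempty_iff_ne_empty.2 hne
  obtain ⟨W, hW, hxW, hWV⟩ := hb.exists_subset_of_mem_open hxV hV
  refine hxO ⟨W, ⟨hW, mono W (⋃₀ {O, V ∩ Oᶜ}) (fun y hy => ?_) (sUnion _ ?_ ?_)⟩, hxW⟩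
  · by_cases hyO : y ∈ O
    · exact ⟨O, by simp, hyO⟩
    · exact ⟨V ∩ Oᶜ, by simp, hWV hy, hyO⟩
  · exact (Set.toFinite _).countable
  · rintro A (rfl | rfl)
    exacts [hO, hJ]

/-- Either a set is covered by countably many members of `𝒮`, or it has a nonempty subset in which
every member of `𝒮` has dense complement. -/
theorem exists_countable_cover_or_exists_dense_compl {X : Type*} [TopologicalSpace X]
    [SecondCountableTopology X] (𝒮 : Set (Set X)) (T : Set X) :
    (∃ 𝒮₀ ⊆ 𝒮, 𝒮₀.Countable ∧ T ⊆ ⋃₀ 𝒮₀) ∨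
      ∃ D ⊆ T, D.Nonempty ∧ ∀ S ∈ 𝒮, D ⊆ closure (D \ S) := by
  obtain ⟨P, -, ⟨𝒮₀, h𝒮₀, hc, hcov⟩, hmax⟩ :=
    exists_isClosed_forall_isOpen_inter
      (fun A => ∃ 𝒮₀ ⊆ 𝒮, 𝒮₀.Countable ∧ T ∩ A ⊆ ⋃₀ 𝒮₀)
      (fun A B hAB ⟨𝒮₀, h₁, h₂, h₃⟩ => ⟨𝒮₀, h₁, h₂, (inter_subset_inter_right _ hAB).trans h₃⟩)
      (by
        intro 𝒜 h𝒜 h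
        choose! f h₁ h₂ h₃ using h
        refine ⟨⋃ A ∈ 𝒜, f A, iUnion₂_subset h₁, h𝒜.biUnion h₂, ?_⟩
        rintro x ⟨hxT, A, hA, hxA⟩
        obtain ⟨S, hS, hxS⟩ := h₃ A hA ⟨hxT, hxA⟩
        exact ⟨S, mem_biUnion hA hS, hxS⟩)
  rcases (T ∩ P).eq_empty_or_nonempty with he | hne
  · refine .inl ⟨𝒮₀, h𝒮₀, hc, fun x hx => hcov ⟨hx, fun hxP => ?_⟩⟩
    exact (he ▸ ⟨hx, hxP⟩ : x ∈ (∅ : Set X))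
  · refine .inr ⟨T ∩ P, inter_subset_left, hne, fun S hS x hx => ?_⟩
    by_contra hxc
    have : x ∈ (closure ((T ∩ P) \ S))ᶜ ∩ P := ⟨hxc, hx.2⟩
    rw [hmax _ isClosed_closure.isOpen_compl ⟨{S}, by simpa, by simp, ?_⟩] at this
    · exact this
    · rintro y ⟨hyT, hyc, hyP⟩
      by_contra hyS
      exact hyc (subset_closure ⟨⟨hyT, hyP⟩, by simpa using hyS⟩)

section Hyperspace

variable {E : Type*} [MetricSpace E]

theorem mem_starSet_comm {K L : Closeds E} :
    L ∈ starSet (K : Set E) ↔ K ∈ starSet (L : Set E) := by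
  simp only [starSet, mem_ofPred_eq, inter_comm]

/-- `D` is thin for `I` if for each `K ∈ I` the members of `D` missing `K` are dense in `D`. -/
def IsThin (I D : Set (Closeds E)) : Prop :=
  ∀ K ∈ I, D ⊆ closure (D \ starSet (K : Set E))

theorem IsThin.closure {I D : Set (Closeds E)} (h : IsThin I D) : IsThin I (closure D) :=
  fun K hK => closure_minimal
    ((h K hK).trans (closure_mono (sdiff_subset_sdiff_left subset_closure))) isClosed_closure

theorem IsThin.iUnion {ι : Type*} {I : Set (Closeds E)} {D : ι → Set (Closeds E)}
    (h : ∀ i, IsThin I (D i)) : IsThin I (⋃ i, D i) :=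
  fun K hK => iUnion_subset fun i => (h i K hK).trans
    (closure_mono (sdiff_subset_sdiff_left (subset_iUnion D i)))

theorem IsThin.inter_isOpen {I D V : Set (Closeds E)} (h : IsThin I D) (hV : IsOpen V) :
    IsThin I (D ∩ V) := by
  rintro K hK L ⟨hLD, hLV⟩
  have := hV.inter_closure ⟨hLV, h K hK hLD⟩
  exact closure_mono (by rintro M ⟨hMV, hMD, hMK⟩; exact ⟨⟨hMD, hMV⟩, hMK⟩) this

theorem IsThin.image2_sup {I D D' : Set (Closeds E)} (h : IsThin I D) (h' : IsThin I D') :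
    IsThin I (image2 (· ⊔ ·) D D') := by
  rintro K hK _ ⟨L, hL, L', hL', rfl⟩
  refine closure_mono ?_ (map_mem_closure₂ continuous_sup (h K hK hL) (h' K hK hL')
    (fun a ha b hb => mem_image2_of_mem ha hb))
  rintro _ ⟨M, hM, M', hM', rfl⟩
  refine ⟨⟨M, hM.1, M', hM'.1, rfl⟩, ?_⟩
  rintro ⟨x, hx | hx, hxK⟩
  exacts [hM.2 ⟨x, hx, hxK⟩, hM'.2 ⟨x, hx, hxK⟩]

variable [CompactSpace E]

theorem isClosed_starSet (K : Closeds E) : IsClosed (starSet (K : Set E)) := by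
  have hopen : IsOpen (starSet (K : Set E))ᶜ := by
    rw [EMetric.isOpen_iff]
    intro L hL
    have hd : Disjoint (L : Set E) K := by
      rw [disjoint_iff_inter_eq_empty, ← not_nonempty_iff_eq_empty]; exact hL
    obtain ⟨δ, hδ, h⟩ := hd.exists_thickenings L.isClosed.isCompact K.isClosed
    refine ⟨ENNReal.ofReal δ, by simpa using hδ, fun L' hL' ⟨x, hxL', hxK⟩ => ?_⟩
    obtain ⟨y, hy, hxy⟩ := Metric.exists_edist_lt_of_hausdorffEDist_lt hxL' hL'
    refine disjoint_left.1 h ?_ (Metric.self_subset_thickening hδ _ hxK)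
    exact Metric.mem_thickening_iff_exists_edist_lt _ _ |>.2 ⟨y, hy, hxy⟩
  simpa using hopen.isClosed_compl

theorem IsThin.meagerIn {I D : Set (Closeds E)} (h : IsThin I D) {K : Closeds E} (hK : K ∈ I) :
    MeagerIn (starSet (K : Set E)) D := by
  refine IsNowhereDense.isMeagre ?_
  refine (isClosed_isNowhereDense_iff_compl.2 ⟨?_, ?_⟩).2
  · exact ((isClosed_starSet K).preimage continuous_subtype_val).isOpen_compl
  · intro x
    rw [closure_subtype]
    refine closure_mono ?_ (h K hK x.2)
    rintro L ⟨hLD, hLK⟩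
    exact ⟨⟨L, hLD⟩, hLK, rfl⟩

/-- In a nonempty relatively open part of a closed `F`, some member misses `K` if `K*` is meager
in `F`. -/
theorem MeagerIn.not_subset {F : Set (Closeds E)} (hF : IsClosed F) {S : Set (Closeds E)}
    (h : MeagerIn S F) {V : Set (Closeds E)} (hV : IsOpen V) (hne : (F ∩ V).Nonempty) :
    ¬ F ∩ V ⊆ S := by
  intro hsub
  have : CompactSpace F := isCompact_iff_compactSpace.1 hF.isCompact
  obtain ⟨L, hLF, hLV⟩ := hne
  exact not_isMeagre_of_isOpen (hV.preimage (continuous_subtype_val (p := (· ∈ F))))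
    ⟨⟨L, hLF⟩, hLV⟩ (h.mono fun x hx => hsub ⟨x.2, hx⟩)

/-- If `I` has property (*) and `Iᶜ` is analytic, there are countably many nonempty thin sets such
that each `K ∉ I` meets all members of one of them. -/
theorem HasPropertyStar.exists_isThin_cover {I : Set (Closeds E)} (hI : HasPropertyStar I)
    (hco : MeasureTheory.AnalyticSet Iᶜ) (hne : I.Nonempty) (hne' : Iᶜ.Nonempty) :
    ∃ F : ℕ → Set (Closeds E), (∀ n, IsThin I (F n) ∧ (F n).Nonempty) ∧
      ∀ K ∉ I, ∃ n, F n ⊆ starSet (K : Set E) := by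
  rw [MeasureTheory.AnalyticSet] at hco
  obtain ⟨φ, hφ, hrange⟩ := hco.resolve_left hne'.ne_empty
  obtain ⟨P, hP, hJ, hmax⟩ := exists_isClosed_forall_isOpen_inter
    (fun A : Set (ℕ → ℕ) => ∃ 𝒟 : Set (Set (Closeds E)), 𝒟.Countable ∧
      (∀ D ∈ 𝒟, IsThin I D ∧ D.Nonempty) ∧ ∀ p ∈ A, ∃ D ∈ 𝒟, D ⊆ starSet (φ p : Set E))
    (fun A B hAB ⟨𝒟, h₁, h₂, h₃⟩ => ⟨𝒟, h₁, h₂, fun p hp => h₃ p (hAB hp)⟩)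
    (by
      intro 𝒜 h𝒜 h
      choose! f h₁ h₂ h₃ using h
      refine ⟨⋃ A ∈ 𝒜, f A, h𝒜.biUnion h₁, ?_, ?_⟩
      · intro D hD
        obtain ⟨A, hA, hDA⟩ := mem_iUnion₂.1 hD
        exact h₂ A hA D hDA
      · rintro p ⟨A, hA, hpA⟩
        obtain ⟨D, hD, hDp⟩ := h₃ A hA p hpA
        exact ⟨D, mem_biUnion hA hD, hDp⟩)
  rcases P.eq_empty_or_nonempty with rfl | hPne
  · obtain ⟨𝒟, h₁, h₂, h₃⟩ := hJ
    have hcover : ∀ K ∉ I, ∃ D ∈ 𝒟, D ⊆ starSet (K : Set E) := by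
      intro K hK
      obtain ⟨p, rfl⟩ : K ∈ range φ := hrange ▸ hK
      exact h₃ p (by simp)
    obtain ⟨K, hK⟩ := hne'
    obtain ⟨D, hD, -⟩ := hcover K hK
    obtain ⟨F, rfl⟩ := h₁.exists_eq_range ⟨D, hD⟩
    refine ⟨F, fun n => h₂ _ ⟨n, rfl⟩, fun K hK => ?_⟩
    obtain ⟨_, ⟨n, rfl⟩, h⟩ := hcover K hK
    exact ⟨n, h⟩
  exfalso
  -- Transversals of nonempty relatively open parts of `P` meet members of a countable family.
  have hcov : ∀ V ∈ countableBasis (ℕ → ℕ), (V ∩ P).Nonempty →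
      ∃ 𝒦 : Set (Closeds E), 𝒦.Countable ∧ 𝒦 ⊆ I ∧
        ∀ L : Closeds E, (∀ p ∈ V ∩ P, L ∈ starSet (φ p : Set E)) →
          ∃ K ∈ 𝒦, L ∈ starSet (K : Set E) := by
    intro V hV hVP
    rcases exists_countable_cover_or_exists_dense_compl
      ((fun K : Closeds E => starSet (K : Set E)) '' I)
      {L | ∀ p ∈ V ∩ P, L ∈ starSet (φ p : Set E)} with ⟨𝒮, h𝒮, hc, hsub⟩ | ⟨D, hD, hDne, hthin⟩
    · have hsurj : ∀ S ∈ 𝒮, ∃ K ∈ I, starSet (K : Set E) = S := fun S hS => h𝒮 hS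
      choose! g hgI hg using hsurj
      refine ⟨g '' 𝒮, hc.image g, image_subset_iff.2 hgI, fun L hL => ?_⟩
      obtain ⟨S, hS, hLS⟩ := hsub hL
      exact ⟨g S, mem_image_of_mem g hS, (hg S hS).symm ▸ hLS⟩
    · refine absurd (hmax V (isOpen_of_mem_countableBasis hV) ⟨{D}, by simp, ?_, ?_⟩)
        hVP.ne_empty
      · rintro _ rfl
        exact ⟨fun K hK => hthin _ ⟨K, hK, rfl⟩, hDne⟩
      · exact fun p hp => ⟨D, rfl, fun L hL => hD hL p hp⟩
  choose! 𝒦 h𝒦c h𝒦I h𝒦 using hcov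
  obtain ⟨K₀, hK₀⟩ := hne
  obtain ⟨f, hf⟩ : ∃ f : ℕ → Closeds E, insert K₀
      (⋃ V ∈ {V ∈ countableBasis (ℕ → ℕ) | (V ∩ P).Nonempty}, 𝒦 V) = range f :=
    Countable.exists_eq_range (Countable.insert _ (((countable_countableBasis _).mono
      fun _ h => h.1).biUnion fun V hV => h𝒦c V hV.1 hV.2)) (insert_nonempty _ _)
  obtain ⟨G, hG, hfG, hGI⟩ := hI f (by
    intro n
    have : f n ∈ range f := ⟨n, rfl⟩
    rw [← hf] at this
    rcases this with h | h
    · rwa [h]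
    · obtain ⟨V, hV, h⟩ := mem_iUnion₂.1 h
      exact h𝒦I V hV.1 hV.2 h)
  obtain ⟨U, hU, rfl⟩ := hG.eq_iInter_nat
  let H : ℕ → Closeds E := fun m => ⟨(U m)ᶜ, (hU m).isClosed_compl⟩
  have : PolishSpace P := hP.polishSpace
  have : Nonempty P := hPne.to_subtype
  obtain ⟨m, ⟨x, hxP⟩, hx⟩ := nonempty_interior_of_iUnion_of_closed
    (f := fun m => {p : P | φ p ∈ starSet (H m : Set E)})
    (fun m => (isClosed_starSet (H m)).preimage (hφ.comp continuous_subtype_val)) (by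
      refine eq_univ_of_forall fun p => ?_
      have hp : φ p ∉ I := by
        change φ p ∈ Iᶜ
        exact hrange ▸ ⟨p, rfl⟩
      obtain ⟨y, hy, hyG⟩ := not_subset.1 (mt (hGI (φ p)) hp)
      obtain ⟨m, hm⟩ := not_forall.1 (mt mem_iInter.2 hyG)
      exact mem_iUnion.2 ⟨m, y, hy, hm⟩)
  obtain ⟨W, hW, hWeq⟩ := isOpen_induced_iff.1
    (isOpen_interior (s := {p : P | φ p ∈ starSet (H m : Set E)}))
  have hxW : x ∈ W := by
    have : (⟨x, hxP⟩ : P) ∈ Subtype.val ⁻¹' W := hWeq ▸ hx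
    exact this
  obtain ⟨V, hV, hxV, hVW⟩ := (isBasis_countableBasis (ℕ → ℕ)).exists_subset_of_mem_open hxW hW
  obtain ⟨K, hK, y, hyH, hyK⟩ := h𝒦 V hV ⟨x, hxV, hxP⟩ (H m) (by
    rintro p ⟨hpV, hpP⟩
    have : (⟨p, hpP⟩ : P) ∈ Subtype.val ⁻¹' W := hVW hpV
    rw [hWeq] at this
    have hp : (⟨p, hpP⟩ : P) ∈ {p : P | φ p ∈ starSet (H m : Set E)} := interior_subset this
    exact mem_starSet_comm.1 hp)
  obtain ⟨n, rfl⟩ : K ∈ range f :=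
    hf ▸ Or.inr (mem_biUnion (show V ∈ {V ∈ countableBasis (ℕ → ℕ) | (V ∩ P).Nonempty} from
      ⟨hV, x, hxV, hxP⟩) hK)
  exact hyH (mem_iInter.1 (hfG (mem_iUnion.2 ⟨n, hyK⟩)) m)

/-- The thin sets covering the complement of `I` can be taken closed and decreasing. -/
theorem exists_antitone_isThin {I : Set (Closeds E)} {F : ℕ → Set (Closeds E)}
    (hF : ∀ n, IsThin I (F n) ∧ (F n).Nonempty) (hcov : ∀ K ∉ I, ∃ n, F n ⊆ starSet (K : Set E)) :
    ∃ G : ℕ → Set (Closeds E), Antitone G ∧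
      (∀ n, IsClosed (G n) ∧ IsThin I (G n) ∧ (G n).Nonempty) ∧
      ∀ K ∉ I, ∃ n, G n ⊆ starSet (K : Set E) := by
  let S : ℕ → Set (Closeds E) := fun n =>
    Nat.rec (F 0) (fun n D => image2 (· ⊔ ·) D (F (n + 1))) n
  have hS : ∀ n, IsThin I (S n) ∧ (S n).Nonempty := by
    intro n
    induction n with
    | zero => exact hF 0
    | succ n ih => exact ⟨ih.1.image2_sup (hF (n + 1)).1, ih.2.image2 (hF (n + 1)).2⟩
  have hFS : ∀ n (K : Closeds E), F n ⊆ starSet (K : Set E) → S n ⊆ starSet (K : Set E) := by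
    rintro (_ | n) K h
    · exact h
    · rintro _ ⟨L, -, L', hL', rfl⟩
      obtain ⟨x, hx, hxK⟩ := h hL'
      exact ⟨x, Or.inr hx, hxK⟩
  have hSS : ∀ (K : Closeds E) n, S n ⊆ starSet (K : Set E) →
      ∀ m, n ≤ m → S m ⊆ starSet (K : Set E) := by
    intro K n h m hm
    induction m, hm using Nat.le_induction with
    | base => exact h
    | succ m _ ih =>
      rintro _ ⟨L, hL, L', -, rfl⟩
      obtain ⟨x, hx, hxK⟩ := ih hL
      exact ⟨x, Or.inl hx, hxK⟩
  refine ⟨fun n => closure (⋃ m : Ici n, S m), ?_, fun n => ⟨isClosed_closure, ?_, ?_⟩, ?_⟩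
  · intro n m hnm
    refine closure_mono (iUnion_subset fun k => ?_)
    exact subset_iUnion (fun k : Ici n => S k) ⟨k, hnm.trans k.2⟩
  · exact (IsThin.iUnion fun m : Ici n => (hS m).1).closure
  · exact ((hS n).2.mono (subset_iUnion (fun k : Ici n => S k) ⟨n, self_mem_Ici⟩)).closure
  · intro K hK
    obtain ⟨n, hn⟩ := hcov K hK
    exact ⟨n, closure_minimal (iUnion_subset fun m => hSS K n (hFS n K hn) m m.2)
      (isClosed_starSet K)⟩

/-- A decreasing sequence of closed thin sets can be merged into a single closed thin set having,
for each `n`, a nonempty relatively open part inside the `n`-th set. -/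
theorem exists_isThin_inter_isOpen_subset {I : Set (Closeds E)} {G : ℕ → Set (Closeds E)}
    (hanti : Antitone G) (hG : ∀ n, IsClosed (G n) ∧ IsThin I (G n) ∧ (G n).Nonempty) :
    ∃ F : Set (Closeds E), IsClosed F ∧ IsThin I F ∧
      ∀ n, ∃ V, IsOpen V ∧ (F ∩ V).Nonempty ∧ F ∩ V ⊆ G n := by
  obtain ⟨L, hL⟩ := IsCompact.nonempty_iInter_of_sequence_nonempty_isCompact_isClosed G
    (fun n => hanti n.le_succ) (fun n => (hG n).2.2) (hG 0).1.isCompact (fun n => (hG n).1)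
  rw [mem_iInter] at hL
  by_cases hiso : ∃ n V, IsOpen V ∧ L ∈ V ∧ G n ∩ V ⊆ {L}
  · obtain ⟨n, V, hV, hLV, hsub⟩ := hiso
    have heq : G n ∩ V = {L} := hsub.antisymm (singleton_subset_iff.2 ⟨hL n, hLV⟩)
    refine ⟨{L}, isClosed_singleton, heq ▸ (hG n).2.1.inter_isOpen hV, fun m => ⟨univ,
      isOpen_univ, by simp, by simpa using hL m⟩⟩
  · push Not at hiso
    obtain ⟨W, hW⟩ := (nhds L).exists_antitone_basis
    have hx : ∀ k, ∃ x ∈ G k ∩ interior (W k), x ≠ L := fun k => by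
      by_contra! h
      exact hiso k _ isOpen_interior (mem_interior_iff_mem_nhds.2 (hW.mem k)) h
    choose x hxG hxL using hx
    choose V U hV hU hxV hLU hVU using fun k => t2_separation (hxL k)
    have hLF : L ∈ closure (⋃ k, G k ∩ V k) :=
      mem_closure_of_tendsto (hW.tendsto fun k => interior_subset (hxG k).2)
        (.of_forall fun k => mem_iUnion.2 ⟨k, (hxG k).1, hxV k⟩)
    refine ⟨closure (⋃ k, G k ∩ V k), isClosed_closure,
      (IsThin.iUnion fun k => (hG k).2.1.inter_isOpen (hV k)).closure, fun n => ?_⟩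
    have hO : IsOpen (⋂ k ∈ Iio n, U k) := (finite_Iio n).isOpen_biInter fun k _ => hU k
    refine ⟨⋂ k ∈ Iio n, U k, hO, ⟨L, hLF, mem_iInter₂.2 fun k _ => hLU k⟩, ?_⟩
    rintro y ⟨hyF, hyU⟩
    refine closure_minimal ?_ (hG n).1 (hO.inter_closure ⟨hyU, hyF⟩)
    rintro z ⟨hzU, hz⟩
    obtain ⟨k, hzG, hzV⟩ := mem_iUnion.1 hz
    refine hanti (le_of_not_gt fun hk => ?_) hzG
    exact disjoint_left.1 (hVU k) hzV (mem_iInter₂.1 hzU k hk)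

/-- An ideal represented by the meager ideal of a closed set has property (*). -/
theorem hasPropertyStar_of_forall_iff_meagerIn {I F : Set (Closeds E)} (hF : IsClosed F)
    (hrep : ∀ K : Closeds E, K ∈ I ↔ MeagerIn (starSet (K : Set E)) F) : HasPropertyStar I := by
  intro f hf
  have : CompactSpace F := isCompact_iff_compactSpace.1 hF.isCompact
  have hres : (⋃ n, (Subtype.val : F → Closeds E) ⁻¹' starSet (f n : Set E))ᶜ ∈ residual F :=
    isMeagre_iUnion fun n => (hrep _).1 (hf n)
  obtain ⟨D, hD, hDc, hDd⟩ := (dense_of_mem_residual hres).exists_countable_dense_subset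
  refine ⟨⋂ L ∈ D, ((L : Closeds E) : Set E)ᶜ, .biInter_of_isOpen hDc fun L _ =>
    L.1.isClosed.isOpen_compl, ?_, fun K hK => (hrep K).2 ?_⟩
  · refine iUnion_subset fun n x hx => mem_iInter₂.2 fun L hL hxL => ?_
    exact hD hL (mem_iUnion.2 ⟨n, x, hxL, hx⟩)
  · refine ((isClosed_isNowhereDense_iff_compl.2 ⟨?_, hDd.mono fun L hL => ?_⟩).2).isMeagre
    · exact ((isClosed_starSet K).preimage continuous_subtype_val).isOpen_compl
    · rintro ⟨x, hxL, hxK⟩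
      exact mem_iInter₂.1 (hK hxK) L hL hxL

end Hyperspace

/-- Solecki's theorem: a coanalytic nonempty ideal has property (*) iff it is represented
by the meager ideal of a closed subset of the hyperspace. -/
theorem solecki_representation {E : Type*} [MetricSpace E] [CompactSpace E]
    (I : Set (Closeds E)) (hI : IsIdealOfCompacts I)
    (hco : MeasureTheory.AnalyticSet Iᶜ) (hne : I.Nonempty) :
    HasPropertyStar I ↔
      ∃ F : Set (Closeds E), IsClosed F ∧
        ∀ K : Closeds E, K ∈ I ↔ MeagerIn (starSet (K : Set E)) F := by
  constructor
  · intro hstar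
    rcases Iᶜ.eq_empty_or_nonempty with he | hne'
    · refine ⟨∅, isClosed_empty, fun K => iff_of_true ?_ ?_⟩
      · exact compl_empty_iff.1 he ▸ mem_univ K
      · exact IsThin.meagerIn (I := {K}) (fun _ _ => empty_subset _) rfl
    obtain ⟨D, hD, hcov⟩ := hstar.exists_isThin_cover hco hne hne'
    obtain ⟨G, hanti, hG, hcov⟩ := exists_antitone_isThin hD hcov
    obtain ⟨F, hF, hthin, hpart⟩ := exists_isThin_inter_isOpen_subset hanti hG
    refine ⟨F, hF, fun K => ⟨hthin.meagerIn, fun hK => ?_⟩⟩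
    by_contra hKI
    obtain ⟨n, hn⟩ := hcov K hKI
    obtain ⟨V, hV, hne, hsub⟩ := hpart n
    exact hK.not_subset hF hV hne (hsub.trans hn)
  · rintro ⟨F, hF, hrep⟩
    exact hasPropertyStar_of_forall_iff_meagerIn hF hrep
end

section
/- Let E be a compact Polish space and let 𝒦(E) be the hyperspace of compact subsets of E with the Vietoris topology. For any closed set 𝓕 ⊆ 𝒦(E), the family I = {K ∈ 𝒦(E) : K* ∩ 𝓕 is meager in 𝓕} is a σ-ideal of compact sets: it is closed under taking compact subsets, closed under finite unions, and if K_n ∈ I for all n ∈ ℕ and K = ⋃_n K_n is compact, then K ∈ I. -/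
open TopologicalSpace Set

theorem starSet_mono {E : Type*} [TopologicalSpace E] {A B : Set E} (h : A ⊆ B) :
    starSet A ⊆ starSet B :=
  fun _ hK => hK.mono (inter_subset_inter_right _ h)

theorem starSet_union {E : Type*} [TopologicalSpace E] (A B : Set E) :
    starSet (A ∪ B) = starSet A ∪ starSet B := by
  ext K
  simp [starSet, inter_union_distrib_left, union_nonempty]

theorem starSet_iUnion {E : Type*} [TopologicalSpace E] {ι : Sort*} (A : ι → Set E) :
    starSet (⋃ i, A i) = ⋃ i, starSet (A i) := by
  ext K
  simp [starSet, inter_iUnion, nonempty_iUnion]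

/-- For any closed `𝓕 ⊆ 𝒦(E)`, the family `I = {K : K* ∩ 𝓕 meager in 𝓕}` is a σ-ideal:
closed under compact subsets, finite unions, and countable unions that are compact. -/
theorem meager_trace_family_is_sigma_ideal {E : Type*} [MetricSpace E] [CompactSpace E]
    (F : Set (Closeds E)) (hF : IsClosed F) :
    (∀ K L : Closeds E, L ≤ K → MeagerIn (starSet (K : Set E)) F →
        MeagerIn (starSet (L : Set E)) F) ∧
    (∀ K L : Closeds E, MeagerIn (starSet (K : Set E)) F →
        MeagerIn (starSet (L : Set E)) F → MeagerIn (starSet ((K ⊔ L : Closeds E) : Set E)) F) ∧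
    (∀ f : ℕ → Closeds E, (∀ n, MeagerIn (starSet ((f n : Closeds E) : Set E)) F) →
        ∀ K : Closeds E, (K : Set E) = ⋃ n, (f n : Set E) →
          MeagerIn (starSet (K : Set E)) F) := by
  refine ⟨fun K L hLK hK => hK.mono (preimage_mono (starSet_mono hLK)), fun K L hK hL => ?_,
    fun f hf K hK => ?_⟩
  · unfold MeagerIn
    rw [Closeds.coe_sup, starSet_union, preimage_union]
    exact hK.union hL
  · unfold MeagerIn
    rw [hK, starSet_iUnion, preimage_iUnion]
    exact isMeagre_iUnion hf
end
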